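/- Let p ≥ 1 and q ≥ 2 be integers with p + q odd. Then 2·∑_{n=1}^∞ h_n^{(p)}/n^q = -(-1)^p·(1+(-1)^q)·t̃(p)·ζ(q) - (-1)^p·C(p+q-1, p-1)·t̃(p+q) - (-1)^p·∑_{k=0}^{p-1} ((-1)^k - 1)·C(p+q-k-2, q-1)·t̃(k+1)·t̃(p+q-k-1) + 2·(-1)^p·∑_{j=1}^{⌊q/2⌋} C(p+q-2j-1, p-1)·ζ(2j)·t̃(p+q-2j), where t̃(j) := (2^j - 1)·ζ(j) for j ≥ 2 and t̃(1) := 2·log 2. -/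

import Mathlib

open scoped BigOperators

/-- ζ(p) = ∑_{n=1}^∞ 1/n^p, with the convention ζ(1) := 0. -/
noncomputable def zetaC (p : ℕ) : ℝ :=
  if p = 1 then 0 else ∑' n : ℕ, 1 / ((n : ℝ) + 1) ^ p

/-- t̃(j) = ∑_{k=1}^∞ 1/(k−1/2)^j for j ≥ 2, with t̃(1) := 2·log 2. -/
noncomputable def ttil (j : ℕ) : ℝ :=
  if j = 1 then 2 * Real.log 2 else ∑' k : ℕ, 1 / ((k : ℝ) + 1 / 2) ^ j

/-- ζ̄(j) = ∑_{k=1}^∞ (−1)^{k−1}/k^j -/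
noncomputable def zbar (j : ℕ) : ℝ := ∑' k : ℕ, (-1 : ℝ) ^ k / ((k : ℝ) + 1) ^ j

/-- t̄(j) = ∑_{k=1}^∞ (−1)^{k−1}/(k−1/2)^j -/
noncomputable def tbar (j : ℕ) : ℝ := ∑' k : ℕ, (-1 : ℝ) ^ k / ((k : ℝ) + 1 / 2) ^ j

/-- Odd harmonic number h_n^{(p)} = ∑_{k=1}^n 1/(k−1/2)^p -/
noncomputable def oddH (p n : ℕ) : ℝ := ∑ k ∈ Finset.range n, 1 / ((k : ℝ) + 1 / 2) ^ p

/-- Alternating odd harmonic number h̄_n^{(p)} = ∑_{k=1}^n (−1)^{k−1}/(k−1/2)^p -/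
noncomputable def altOddH (p n : ℕ) : ℝ :=
  ∑ k ∈ Finset.range n, (-1 : ℝ) ^ k / ((k : ℝ) + 1 / 2) ^ p

/-- one half of the partial fraction decomposition -/
noncomputable def pfA (u w : ℝ) (P Q : ℕ) : ℝ :=
  ∑ i ∈ Finset.range (Q + 1), (Nat.choose (P + Q - i) P : ℝ) * w ^ (P + Q + 1 - i) * u ^ (i + 1)

lemma pf_zero (u v w : ℝ) (h : u * v = w * (u + v)) (P : ℕ) :
    u * v ^ (P + 1) = pfA u w P 0 + pfA v w 0 P := by
  induction P with
  | zero => simp [pfA, h]; ring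
  | succ P ih =>
    have e : pfA v w 0 (P + 1) = w * pfA v w 0 P + w * v ^ (P + 2) := by
      simp only [pfA]
      rw [Finset.sum_range_succ, Finset.mul_sum]
      congr 1
      · apply Finset.sum_congr rfl
        intro i hi
        have hi' := Finset.mem_range.1 hi
        have : 0 + (P + 1) + 1 - i = (0 + P + 1 - i) + 1 := by omega
        rw [this, pow_succ]; simp; ring
      · have : 0 + (P + 1) + 1 - (P + 1) = 1 := by omega
        rw [this]; simp
    have e2 : pfA u w (P + 1) 0 = w * pfA u w P 0 := by
      simp [pfA]; ring
    rw [e, e2]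
    have : u * v ^ (P + 1 + 1) = (u * v) * v ^ (P + 1) := by ring
    rw [this, h]
    linear_combination w * ih

lemma pfA_succ (u w : ℝ) (P Q : ℕ) :
    pfA u w (P + 1) (Q + 1) = w * (pfA u w P (Q + 1) + pfA u w (P + 1) Q) := by
  have e : pfA u w (P + 1) Q = ∑ i ∈ Finset.range (Q + 1 + 1),
      (Nat.choose (P + 1 + Q - i) (P + 1) : ℝ) * w ^ (P + 1 + Q + 1 - i) * u ^ (i + 1) := by
    rw [Finset.sum_range_succ]
    have : P + 1 + Q - (Q + 1) = P := by omega
    rw [this]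
    simp [pfA]
  rw [e]
  simp only [pfA]
  rw [← Finset.sum_add_distrib, Finset.mul_sum]
  apply Finset.sum_congr rfl
  intro i hi
  have hi' := Finset.mem_range.1 hi
  have h1 : P + 1 + (Q + 1) - i = (P + Q + 1 - i) + 1 := by omega
  have h2 : P + 1 + (Q + 1) + 1 - i = (P + Q + 2 - i) + 1 := by omega
  have h3 : P + (Q + 1) - i = P + Q + 1 - i := by omega
  have h4 : P + (Q + 1) + 1 - i = P + Q + 2 - i := by omega
  have h5 : P + 1 + Q - i = P + Q + 1 - i := by omega
  have h6 : P + 1 + Q + 1 - i = P + Q + 2 - i := by omega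
  rw [h1, h2, h3, h4, h5, h6, Nat.choose_succ_succ]
  push_cast
  ring

lemma pf (u v w : ℝ) (h : u * v = w * (u + v)) : ∀ P Q : ℕ,
    u ^ (Q + 1) * v ^ (P + 1) = pfA u w P Q + pfA v w Q P := by
  intro P
  induction P with
  | zero =>
    intro Q
    have := pf_zero v u w (by linarith) Q
    simp only [zero_add, pow_one]
    linarith
  | succ P ihP =>
    intro Q
    induction Q with
    | zero =>
      have := pf_zero u v w h (P + 1)
      simp only [zero_add, pow_one]
      linarith
    | succ Q ihQ =>
      rw [pfA_succ, pfA_succ]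
      have h1 := ihP (Q + 1)
      have : u ^ (Q + 1 + 1) * v ^ (P + 1 + 1) = (u * v) * (u ^ (Q + 1) * v ^ (P + 1)) := by ring
      rw [this, h]
      linear_combination w * h1 + w * ihQ

lemma tele (f : ℕ → ℝ) (hf : Filter.Tendsto f Filter.atTop (nhds 0)) (N : ℕ)
    (hs : Summable fun k => f (k + N) - f k) :
    HasSum (fun k => f (k + N) - f k) (-∑ j ∈ Finset.range N, f j) := by
  have h1 := hs.hasSum.tendsto_sum_nat
  have e : ∀ M, ∑ k ∈ Finset.range M, (f (k + N) - f k)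
      = ∑ j ∈ Finset.range N, f (M + j) - ∑ j ∈ Finset.range N, f j := by
    intro M
    rw [Finset.sum_sub_distrib]
    have a1 := Finset.sum_range_add f M N
    have a2 := Finset.sum_range_add f N M
    rw [add_comm N M] at a2
    simp only [add_comm N] at a2
    linarith
  have h2 : Filter.Tendsto (fun M => ∑ k ∈ Finset.range M, (f (k + N) - f k)) Filter.atTop
      (nhds (-∑ j ∈ Finset.range N, f j)) := by
    simp only [e]
    have : Filter.Tendsto (fun M => ∑ j ∈ Finset.range N, f (M + j)) Filter.atTop
        (nhds (∑ j ∈ Finset.range N, 0)) := by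
      apply tendsto_finsetSum
      intro j _
      exact hf.comp (Filter.tendsto_add_atTop_nat j)
    simpa using this.sub_const (∑ j ∈ Finset.range N, f j)
  have := tendsto_nhds_unique h1 h2
  rw [← this]; exact hs.hasSum

lemma summ_half (i : ℕ) (hi : 2 ≤ i) :
    Summable fun n : ℤ => (((n : ℝ) + 1 / 2)⁻¹) ^ i := by
  have := (Real.summable_one_div_int_add_rpow (1 / 2) i).2 (by exact_mod_cast hi)
  apply Summable.of_abs
  refine this.congr ?_
  intro n
  rw [abs_pow, abs_inv, Real.rpow_natCast, inv_pow, one_div]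

lemma summ_int (i : ℕ) (hi : 2 ≤ i) :
    Summable fun n : ℤ => ((n : ℝ)⁻¹) ^ i := by
  have := (Real.summable_one_div_int_add_rpow 0 i).2 (by exact_mod_cast hi)
  apply Summable.of_abs
  refine this.congr ?_
  intro n
  rw [abs_pow, abs_inv, Real.rpow_natCast, inv_pow, one_div, add_zero]

lemma hasSum_ttil (i : ℕ) (hi : 2 ≤ i) :
    HasSum (fun k : ℕ => (((k : ℝ) + 1 / 2)⁻¹) ^ i) (ttil i) := by
  have h := (summ_half i hi).comp_injective (Nat.cast_injective (R := ℤ))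
  have e : ttil i = ∑' k : ℕ, (((k : ℝ) + 1 / 2)⁻¹) ^ i := by
    rw [ttil, if_neg (by omega)]
    congr 1; ext k; simp
  rw [e]
  refine Summable.hasSum (h.congr fun k => ?_)
  simp

lemma hasSum_zetaC (i : ℕ) (hi : 2 ≤ i) :
    HasSum (fun k : ℕ => (((k : ℝ) + 1)⁻¹) ^ i) (zetaC i) := by
  have h := (summ_int i hi).comp_injective (i := fun k : ℕ => (k : ℤ) + 1)
    (fun a b h => by simpa using h)
  have e : zetaC i = ∑' k : ℕ, (((k : ℝ) + 1)⁻¹) ^ i := by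
    rw [zetaC, if_neg (by omega)]
    congr 1; ext k; simp
  rw [e]
  refine Summable.hasSum (h.congr fun k => ?_)
  simp

lemma hZ (i : ℕ) (hi : 2 ≤ i) :
    HasSum (fun n : ℤ => ((n : ℝ)⁻¹) ^ i) ((1 + (-1) ^ i) * zetaC i) := by
  have h1 := hasSum_zetaC i hi
  have h := HasSum.of_add_one_of_neg_add_one (f := fun n : ℤ => ((n : ℝ)⁻¹) ^ i)
    (m := zetaC i) (m' := (-1) ^ i * zetaC i) ?_ ?_
  · convert h using 1
    have : i ≠ 0 := by omega
    simp [this]; ring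
  · convert h1 using 2 with k
    push_cast; rfl
  · refine Eq.subst (motive := fun f => HasSum f _) (funext fun k => ?_) (h1.mul_left ((-1) ^ i))
    rw [← mul_pow]
    congr 1
    push_cast
    rw [neg_one_mul, ← inv_neg]

lemma hY (i : ℕ) (hi : 2 ≤ i) (k : ℕ) :
    HasSum (fun n : ℤ => ((((k : ℝ) + 1 / 2) - n)⁻¹) ^ i) ((1 + (-1) ^ i) * ttil i) := by
  have h1 := hasSum_ttil i hi
  have h := HasSum.of_nat_of_neg_add_one (f := fun n : ℤ => (((n : ℝ) + 1 / 2)⁻¹) ^ i)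
    (m := ttil i) (m' := (-1) ^ i * ttil i) ?_ ?_
  · have h2 := (Equiv.hasSum_iff (Equiv.subLeft (k : ℤ))).2 h
    convert h2 using 1
    · ext n
      simp
      ring
    · ring
  · convert h1 using 2 with k
    push_cast; rfl
  · refine Eq.subst (motive := fun f => HasSum f _) (funext fun k => ?_) (h1.mul_left ((-1) ^ i))
    rw [← mul_pow]
    congr 1
    push_cast
    rw [neg_one_mul, ← inv_neg]
    congr 1
    ring

lemma half_ne (m : ℤ) : ((m : ℝ) + 1 / 2) ≠ 0 := by
  intro h
  have h2 : (2 * m + 1 : ℝ) = 0 := by linarith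
  have h3 : (2 * m + 1 : ℤ) = 0 := by exact_mod_cast h2
  omega

lemma half_inv_le (m : ℤ) : |((m : ℝ) + 1 / 2)⁻¹| ≤ 2 := by
  rw [abs_inv]
  apply inv_le_of_inv_le₀ (by norm_num)
  rcases le_or_gt 0 m with h | h
  · have : (0 : ℝ) ≤ m := by exact_mod_cast h
    rw [abs_of_nonneg (by linarith)]; linarith
  · have : (m : ℝ) + 1 ≤ 0 := by exact_mod_cast h
    rw [abs_of_nonpos (by linarith)]; linarith

lemma a_sub (n : ℤ) (k : ℕ) : (k : ℝ) + 1 / 2 - n = (((k : ℤ) - n : ℤ) : ℝ) + 1 / 2 := by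
  push_cast; ring

lemma a_sub_ne (n : ℤ) (k : ℕ) : (k : ℝ) + 1 / 2 - n ≠ 0 := by
  rw [a_sub]; exact half_ne _

lemma a_ne (k : ℕ) : (k : ℝ) + 1 / 2 ≠ 0 := by positivity

lemma diff_bound (P : ℕ) (n : ℤ) (k : ℕ) :
    |(((k : ℝ) + 1 / 2 - n)⁻¹) ^ (P + 1) - (((k : ℝ) + 1 / 2)⁻¹) ^ (P + 1)| ≤
      ((P + 1) * 2 ^ P) * (|(n : ℝ)| * (|((k : ℝ) + 1 / 2 - n)⁻¹| * |((k : ℝ) + 1 / 2)⁻¹|)) := by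
  have h := abs_pow_sub_pow_le (((k : ℝ) + 1 / 2 - n)⁻¹) (((k : ℝ) + 1 / 2)⁻¹) (P + 1)
  have e : ((k : ℝ) + 1 / 2 - n)⁻¹ - ((k : ℝ) + 1 / 2)⁻¹
      = n * (((k : ℝ) + 1 / 2 - n)⁻¹ * ((k : ℝ) + 1 / 2)⁻¹) := by
    have h1 := a_sub_ne n k
    have h2 := a_ne k
    rw [inv_sub_inv h1 h2, div_eq_mul_inv, mul_inv]
    ring
  rw [e, abs_mul, abs_mul] at h
  refine h.trans ?_
  have hv : |((k : ℝ) + 1 / 2 - n)⁻¹| ≤ 2 := by rw [a_sub]; exact half_inv_le _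
  have hw : |((k : ℝ) + 1 / 2)⁻¹| ≤ 2 := by simpa using half_inv_le k
  have hm : max |((k : ℝ) + 1 / 2 - n)⁻¹| |((k : ℝ) + 1 / 2)⁻¹| ^ (P + 1 - 1) ≤ 2 ^ P := by
    rw [Nat.add_sub_cancel]
    exact pow_le_pow_left₀ (le_max_of_le_left (abs_nonneg _)) (max_le hv hw) _
  calc _ ≤ |(n : ℝ)| * (|((k : ℝ) + 1 / 2 - n)⁻¹| * |((k : ℝ) + 1 / 2)⁻¹|) * ((P + 1 : ℕ) : ℝ) * 2 ^ P := by
        gcongr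
    _ = _ := by push_cast; ring

lemma summ_half_nat (n : ℤ) (i : ℕ) (hi : 2 ≤ i) :
    Summable fun k : ℕ => (((k : ℝ) + 1 / 2 - n)⁻¹) ^ i := by
  have h := (summ_half i hi).comp_injective (i := fun k : ℕ => (k : ℤ) - n)
    (fun a b h => by simpa using h)
  refine h.congr fun k => ?_
  simp only [Function.comp, a_sub]

lemma summ_row (P : ℕ) (n : ℤ) : Summable fun k : ℕ =>
    (((k : ℝ) + 1 / 2 - n)⁻¹) ^ (P + 1) - (((k : ℝ) + 1 / 2)⁻¹) ^ (P + 1) := by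
  have s1 := summ_half_nat n 2 le_rfl
  have s2 := (hasSum_ttil 2 le_rfl).summable
  refine Summable.of_norm_bounded
    (((s1.add s2).mul_left |(n : ℝ)|).mul_left ((P + 1) * 2 ^ P : ℝ)) fun k => ?_
  rw [Real.norm_eq_abs]
  refine (diff_bound P n k).trans ?_
  gcongr
  rw [← sq_abs (((k : ℝ) + 1 / 2 - n)⁻¹), ← sq_abs (((k : ℝ) + 1 / 2)⁻¹)]
  nlinarith [sq_nonneg (|((k : ℝ) + 1 / 2 - n)⁻¹| - |((k : ℝ) + 1 / 2)⁻¹|),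
    sq_nonneg (|((k : ℝ) + 1 / 2 - n)⁻¹| + |((k : ℝ) + 1 / 2)⁻¹|)]

lemma tend_half (c : ℝ) (P : ℕ) : Filter.Tendsto (fun k : ℕ => (((k : ℝ) + c)⁻¹) ^ (P + 1))
    Filter.atTop (nhds 0) := by
  have h : Filter.Tendsto (fun k : ℕ => (k : ℝ) + c) Filter.atTop Filter.atTop :=
    Filter.tendsto_atTop_add_const_right _ _ tendsto_natCast_atTop_atTop
  simpa using (tendsto_inv_atTop_zero.comp h).pow (P + 1)

lemma row_neg (P N : ℕ) : HasSum (fun k : ℕ =>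
    (((k : ℝ) + 1 / 2 - ((-(N : ℤ) : ℤ) : ℝ))⁻¹) ^ (P + 1) - (((k : ℝ) + 1 / 2)⁻¹) ^ (P + 1))
    (-oddH (P + 1) N) := by
  have s := summ_row P (-(N : ℤ))
  have e : (fun k : ℕ =>
    (((k : ℝ) + 1 / 2 - ((-(N : ℤ) : ℤ) : ℝ))⁻¹) ^ (P + 1) - (((k : ℝ) + 1 / 2)⁻¹) ^ (P + 1))
    = fun k : ℕ => (fun k : ℕ => (((k : ℝ) + 1 / 2)⁻¹) ^ (P + 1)) (k + N)
      - (fun k : ℕ => (((k : ℝ) + 1 / 2)⁻¹) ^ (P + 1)) k := by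
    ext k
    push_cast
    congr 3
    ring
  rw [e] at s ⊢
  have := tele _ (tend_half (1 / 2) P) N s
  convert this using 2
  simp [oddH]

lemma row_pos (P N : ℕ) : HasSum (fun k : ℕ =>
    (((k : ℝ) + 1 / 2 - (((N : ℤ) : ℤ) : ℝ))⁻¹) ^ (P + 1) - (((k : ℝ) + 1 / 2)⁻¹) ^ (P + 1))
    ((-1) ^ (P + 1) * oddH (P + 1) N) := by
  have s := (summ_row P (N : ℤ)).neg
  have e : (fun k : ℕ =>
    -((((k : ℝ) + 1 / 2 - (((N : ℤ) : ℤ) : ℝ))⁻¹) ^ (P + 1) - (((k : ℝ) + 1 / 2)⁻¹) ^ (P + 1)))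
    = fun k : ℕ => (fun k : ℕ => (((k : ℝ) + (1 / 2 - N))⁻¹) ^ (P + 1)) (k + N)
      - (fun k : ℕ => (((k : ℝ) + (1 / 2 - N))⁻¹) ^ (P + 1)) k := by
    ext k
    push_cast
    rw [neg_sub]
    congr 3 <;> ring
  rw [e] at s
  have h0 := tele _ (tend_half (1 / 2 - N) P) N s
  rw [← e] at h0
  have h := h0.neg
  simp only [neg_neg] at h
  have ev : (-1) ^ (P + 1) * oddH (P + 1) N
      = ∑ j ∈ Finset.range N, (((j : ℝ) + (1 / 2 - N))⁻¹) ^ (P + 1) := by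
    rw [← Finset.sum_range_reflect, oddH, Finset.mul_sum]
    apply Finset.sum_congr rfl
    intro j hj
    have hj' := Finset.mem_range.1 hj
    have : ((N - 1 - j : ℕ) : ℝ) = N - 1 - j := by
      rw [Nat.cast_sub (by omega), Nat.cast_sub (by omega)]; simp
    rw [this, one_div, ← inv_pow, ← mul_pow, neg_one_mul, ← inv_neg]
    congr 2
    ring
  rw [ev]
  exact h

lemma hT (k : ℕ) : HasSum (fun n : ℤ => (n : ℝ)⁻¹ + ((k : ℝ) + 1 / 2 - n)⁻¹) 0 := by
  have s1 := summ_int 2 le_rfl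
  have s2 := (hY 2 le_rfl k).summable
  have hs : Summable (fun n : ℤ => (n : ℝ)⁻¹ + ((k : ℝ) + 1 / 2 - n)⁻¹) := by
    refine Summable.of_norm_bounded ((s1.add s2).mul_left ((k : ℝ) + 1 / 2)) fun n => ?_
    rw [Real.norm_eq_abs]
    rcases eq_or_ne n 0 with h | h
    · subst h
      have : (0 : ℝ) < k + 1 / 2 := by positivity
      simp only [Int.cast_zero, inv_zero, zero_add, sub_zero]
      rw [abs_of_pos (by positivity)]
      apply le_of_eq
      field_simp
      simp
    · have hn : (n : ℝ) ≠ 0 := by exact_mod_cast h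
      have e : (n : ℝ)⁻¹ + ((k : ℝ) + 1 / 2 - n)⁻¹
          = (k + 1 / 2) * ((n : ℝ)⁻¹ * ((k : ℝ) + 1 / 2 - n)⁻¹) := by
        rw [inv_add_inv hn (a_sub_ne n k), div_eq_mul_inv, mul_inv]; ring
      rw [e, abs_mul, abs_of_pos (show (0 : ℝ) < k + 1 / 2 by positivity)]
      gcongr
      rw [abs_le]
      constructor <;> nlinarith [sq_nonneg ((n : ℝ)⁻¹ + ((k : ℝ) + 1 / 2 - n)⁻¹),
        sq_nonneg ((n : ℝ)⁻¹ - ((k : ℝ) + 1 / 2 - n)⁻¹), sq_nonneg ((n : ℝ)⁻¹),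
        sq_nonneg (((k : ℝ) + 1 / 2 - n)⁻¹)]
  have h1 := hs.hasSum.nat_add_neg
  have e : (fun n : ℕ => (((n : ℤ) : ℝ)⁻¹ + ((k : ℝ) + 1 / 2 - ((n : ℤ) : ℝ))⁻¹)
      + (((-(n : ℤ) : ℤ) : ℝ)⁻¹ + ((k : ℝ) + 1 / 2 - ((-(n : ℤ) : ℤ) : ℝ))⁻¹))
      = fun n : ℕ => (fun n : ℕ => (((n : ℝ) + -(k + 1 / 2))⁻¹) ^ (0 + 1)) (n + (2 * k + 1))
        - (fun n : ℕ => (((n : ℝ) + -(k + 1 / 2))⁻¹) ^ (0 + 1)) n := by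
    ext n
    simp only [zero_add, pow_one]
    push_cast
    have a1 : (n : ℝ) + (2 * k + 1) + -(k + 1 / 2) = k + 1 / 2 - -n := by ring
    have a2 : (n : ℝ) + -(k + 1 / 2) = -(k + 1 / 2 - n) := by ring
    rw [a1, a2, inv_neg, inv_neg]
    ring
  rw [e] at h1
  have h2 := tele _ (tend_half (-(k + 1 / 2)) 0) (2 * k + 1) h1.summable
  have h3 := h1.unique h2
  have h4 : ∑ j ∈ Finset.range (2 * k + 1), ((((j : ℝ) + -(k + 1 / 2))⁻¹) ^ (0 + 1))
      = - ((k : ℝ) + 1 / 2)⁻¹ := by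
    rw [Finset.sum_range_succ']
    have h5 : ∑ j ∈ Finset.range (2 * k), ((((j + 1 : ℕ) : ℝ) + -(k + 1 / 2))⁻¹) ^ (0 + 1) = 0 := by
      have h6 := Finset.sum_range_reflect
        (fun j : ℕ => ((((j + 1 : ℕ) : ℝ) + -(k + 1 / 2))⁻¹) ^ (0 + 1)) (2 * k)
      have h7 : ∑ j ∈ Finset.range (2 * k), ((((2 * k - 1 - j + 1 : ℕ) : ℝ) + -(k + 1 / 2))⁻¹) ^ (0 + 1)
        = - ∑ j ∈ Finset.range (2 * k), ((((j + 1 : ℕ) : ℝ) + -(k + 1 / 2))⁻¹) ^ (0 + 1) := by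
        rw [← Finset.sum_neg_distrib]
        apply Finset.sum_congr rfl
        intro j hj
        have hj' := Finset.mem_range.1 hj
        have : 2 * k - 1 - j + 1 = 2 * k - j := by omega
        rw [this, Nat.cast_sub (by omega)]
        simp only [zero_add, pow_one]
        rw [← inv_neg]
        push_cast
        congr 1
        ring
      linarith
    rw [h5]
    simp only [zero_add, pow_one, Nat.cast_zero]
    rw [inv_neg]
  rw [h4] at h3
  have h8 : ∑' n : ℤ, ((n : ℝ)⁻¹ + ((k : ℝ) + 1 / 2 - n)⁻¹) = 0 := by
    simpa using h3
  rw [← h8]; exact hs.hasSum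

lemma sig_sq (y : ℝ) : √(|y⁻¹|) ^ 2 = |y⁻¹| := Real.sq_sqrt (abs_nonneg _)

lemma sig_cube (c : ℝ) : Summable fun n : ℤ => √(|((n : ℝ) + c)⁻¹|) ^ 3 := by
  have h := (Real.summable_one_div_int_add_rpow c (3 / 2)).2 (by norm_num)
  refine h.congr fun n => ?_
  rw [Real.sqrt_eq_rpow, ← Real.rpow_natCast, ← Real.rpow_mul (abs_nonneg _), abs_inv,
    Real.inv_rpow (abs_nonneg _), one_div]
  norm_num

lemma summ_uvw : Summable fun x : ℤ × ℕ =>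
    |(x.1 : ℝ)⁻¹| * (|((x.2 : ℝ) + 1 / 2 - x.1)⁻¹| * |((x.2 : ℝ) + 1 / 2)⁻¹|) := by
  have s0 := sig_cube 0
  have s1 := sig_cube (1 / 2)
  have m0 := s0.mul_of_nonneg s1 (fun _ => by positivity) (fun _ => by positivity)
  have m1 := s1.mul_of_nonneg s1 (fun _ => by positivity) (fun _ => by positivity)
  have t1 := m0.comp_injective (i := fun x : ℤ × ℕ => (x.1, (x.2 : ℤ)))
    (fun a b h => by simp only [Prod.mk.injEq] at h; exact Prod.ext (by omega) (by omega))
  have t2 := m0.comp_injective (i := fun x : ℤ × ℕ => (x.1, (x.2 : ℤ) - x.1))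
    (fun a b h => by simp only [Prod.mk.injEq] at h; exact Prod.ext (by omega) (by omega))
  have t3 := m1.comp_injective (i := fun x : ℤ × ℕ => ((x.2 : ℤ), (x.2 : ℤ) - x.1))
    (fun a b h => by simp only [Prod.mk.injEq] at h; exact Prod.ext (by omega) (by omega))
  refine Summable.of_nonneg_of_le (fun _ => by positivity) ?_ ((t1.add t2).add t3)
  rintro ⟨n, k⟩
  simp only [Function.comp, ← a_sub, add_zero, Int.cast_natCast]
  have q1 := sig_sq (n : ℝ)
  have q2 := sig_sq ((k : ℝ) + 1 / 2 - n)
  have q3 := sig_sq ((k : ℝ) + 1 / 2)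
  have hx := Real.sqrt_nonneg |(n : ℝ)⁻¹|
  have hy := Real.sqrt_nonneg |((k : ℝ) + 1 / 2 - n)⁻¹|
  have hz := Real.sqrt_nonneg |((k : ℝ) + 1 / 2)⁻¹|
  generalize √|(n : ℝ)⁻¹| = x at *
  generalize √|((k : ℝ) + 1 / 2 - n)⁻¹| = y at *
  generalize √|((k : ℝ) + 1 / 2)⁻¹| = z at *
  have key : ∀ a b c : ℝ, 0 ≤ a → 0 ≤ b → 0 ≤ c → a * b * c ≤ a ^ 3 + b ^ 3 + c ^ 3 := by
    intro a b c ha hb hc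
    have h3 : 3 * (a * b * c) ≤ a ^ 3 + b ^ 3 + c ^ 3 := by
      nlinarith [mul_nonneg (add_nonneg (add_nonneg ha hb) hc)
        (add_nonneg (add_nonneg (sq_nonneg (a - b)) (sq_nonneg (b - c))) (sq_nonneg (c - a)))]
    have : 0 ≤ a * b * c := by positivity
    linarith
  have := key (x * z) (x * y) (z * y) (by positivity) (by positivity) (by positivity)
  calc _ = (x * z) * (x * y) * (z * y) := by rw [← q1, ← q2, ← q3]; ring
    _ ≤ _ := this
    _ = _ := by ring

/-- the double summand -/
noncomputable def gg (P R : ℕ) (n : ℤ) (k : ℕ) : ℝ :=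
  ((n : ℝ)⁻¹) ^ (R + 2) *
    ((((k : ℝ) + 1 / 2 - n)⁻¹) ^ (P + 1) - (((k : ℝ) + 1 / 2)⁻¹) ^ (P + 1))

lemma summ_gg (P R : ℕ) : Summable fun x : ℤ × ℕ => gg P R x.1 x.2 := by
  refine Summable.of_norm_bounded (summ_uvw.mul_left ((P + 1) * 2 ^ P : ℝ)) ?_
  rintro ⟨n, k⟩
  rw [Real.norm_eq_abs, gg, abs_mul]
  rcases eq_or_ne n 0 with h | h
  · subst h
    simp
  · have hn : (n : ℝ) ≠ 0 := by exact_mod_cast h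
    have h1 : |(n : ℝ)⁻¹| ≤ 1 := by
      rw [abs_inv]
      apply inv_le_one_of_one_le₀
      have : (1 : ℤ) ≤ |n| := Int.one_le_abs h
      exact_mod_cast this
    have h2 : |(n : ℝ)⁻¹ ^ (R + 2)| * |(n : ℝ)| ≤ |(n : ℝ)⁻¹| := by
      have : |(n : ℝ)⁻¹ ^ (R + 2)| * |(n : ℝ)| = |(n : ℝ)⁻¹| ^ R * |(n : ℝ)⁻¹| := by
        have h3 : |(n : ℝ)| ≠ 0 := abs_ne_zero.2 hn
        have h4 : |(n : ℝ)⁻¹| * |(n : ℝ)| = 1 := by rw [abs_inv]; exact inv_mul_cancel₀ h3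
        rw [abs_pow, pow_add]
        linear_combination |(n : ℝ)⁻¹| ^ R * |(n : ℝ)⁻¹| * h4
      rw [this]
      have := pow_le_one₀ (n := R) (abs_nonneg _) h1
      nlinarith [abs_nonneg (n : ℝ)⁻¹]
    calc _ ≤ |(n : ℝ)⁻¹ ^ (R + 2)| * (((P + 1) * 2 ^ P) *
          (|(n : ℝ)| * (|((k : ℝ) + 1 / 2 - n)⁻¹| * |((k : ℝ) + 1 / 2)⁻¹|))) := by
          gcongr; exact diff_bound P n k
      _ = ((P + 1) * 2 ^ P) * ((|(n : ℝ)⁻¹ ^ (R + 2)| * |(n : ℝ)|) *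
          (|((k : ℝ) + 1 / 2 - n)⁻¹| * |((k : ℝ) + 1 / 2)⁻¹|)) := by ring
      _ ≤ _ := by gcongr

lemma choose_sum (P Q : ℕ) :
    ∑ i ∈ Finset.range (P + 1), (Nat.choose (P + Q - i) Q : ℝ) = (Nat.choose (P + Q + 1) P : ℝ) := by
  rw [← Finset.sum_range_reflect]
  have h := Nat.sum_range_add_choose P Q
  rw [Nat.choose_symm_of_eq_add (show P + Q + 1 = (Q + 1) + P by ring)] at h
  rw [← h, Nat.cast_sum]
  apply Finset.sum_congr rfl
  intro i hi
  have hi' := Finset.mem_range.1 hi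
  congr 2
  omega

lemma gg_eq (P R : ℕ) (n : ℤ) (k : ℕ) :
    gg P R n k =
      (Nat.choose (P + R + 1) P : ℝ) * (((k : ℝ) + 1 / 2)⁻¹) ^ (P + R + 2) *
          ((n : ℝ)⁻¹ + ((k : ℝ) + 1 / 2 - n)⁻¹)
      + ∑ i ∈ Finset.range R, (Nat.choose (P + R - i) P : ℝ) *
          (((k : ℝ) + 1 / 2)⁻¹) ^ (P + R + 1 - i) * ((n : ℝ)⁻¹) ^ (i + 2)
      + ∑ i ∈ Finset.range P, (Nat.choose (P + R - i) (R + 1) : ℝ) *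
          (((k : ℝ) + 1 / 2)⁻¹) ^ (P + R + 1 - i) * (((k : ℝ) + 1 / 2 - n)⁻¹) ^ (i + 2)
      - (if n = 0 then (Nat.choose (P + R + 2) P : ℝ) * (((k : ℝ) + 1 / 2)⁻¹) ^ (P + R + 3)
          else 0) := by
  have hch : (Nat.choose (R + 1 + P) (R + 1) : ℝ) = (Nat.choose (P + R + 1) P : ℝ) := by
    rw [show R + 1 + P = P + R + 1 by ring, ← Nat.choose_symm_of_eq_add (by ring)]
  -- the second half
  have hB : ∀ v w : ℝ, pfA v w (R + 1) P = (Nat.choose (P + R + 1) P : ℝ) * w ^ (P + R + 2) * v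
      + ∑ i ∈ Finset.range P, (Nat.choose (P + R - i) (R + 1) : ℝ) *
          w ^ (P + R + 1 - i) * v ^ (i + 2) := by
    intro v w
    rw [pfA, Finset.sum_range_succ', add_comm]
    congr 1
    · simp only [Nat.sub_zero, zero_add, pow_one]
      rw [hch]
      congr 3; ring
    · apply Finset.sum_congr rfl
      intro i _
      have h1 : R + 1 + P - (i + 1) = P + R - i := by omega
      have h2 : R + 1 + P + 1 - (i + 1) = P + R + 1 - i := by omega
      rw [h1, h2]
  have hA : ∀ u w : ℝ, pfA u w P (R + 1) = (Nat.choose (P + R + 1) P : ℝ) * w ^ (P + R + 2) * u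
      + ∑ i ∈ Finset.range R, (Nat.choose (P + R - i) P : ℝ) *
          w ^ (P + R + 1 - i) * u ^ (i + 2) + w ^ (P + 1) * u ^ (R + 2) := by
    intro u w
    rw [pfA, Finset.sum_range_succ, Finset.sum_range_succ', add_comm (Finset.sum _ _)]
    congr 1
    · congr 1
      · simp only [Nat.sub_zero, zero_add, pow_one]
        congr 3
      · apply Finset.sum_congr rfl
        intro i _
        have h1 : P + (R + 1) - (i + 1) = P + R - i := by omega
        have h2 : P + (R + 1) + 1 - (i + 1) = P + R + 1 - i := by omega
        rw [h1, h2]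
    · have h1 : P + (R + 1) - (R + 1) = P := by omega
      have h2 : P + (R + 1) + 1 - (R + 1) = P + 1 := by omega
      rw [h1, h2]; simp
  rcases eq_or_ne n 0 with h | h
  · subst h
    simp only [gg, Int.cast_zero, inv_zero, sub_zero, if_true, zero_add]
    have h1 := hB (((k : ℝ) + 1 / 2)⁻¹) (((k : ℝ) + 1 / 2)⁻¹)
    have h2 : pfA (((k : ℝ) + 1 / 2)⁻¹) (((k : ℝ) + 1 / 2)⁻¹) (R + 1) P
        = (Nat.choose (P + R + 2) P : ℝ) * (((k : ℝ) + 1 / 2)⁻¹) ^ (P + R + 3) := by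
      have := choose_sum P (R + 1)
      rw [show P + R + 2 = P + (R + 1) + 1 by ring, ← this, pfA, Finset.sum_mul]
      apply Finset.sum_congr rfl
      intro i hi
      have hi' := Finset.mem_range.1 hi
      rw [mul_assoc, ← pow_add, show R + 1 + P = P + (R + 1) by ring]
      congr 2
      omega
    have h3 : ∑ i ∈ Finset.range R, (Nat.choose (P + R - i) P : ℝ) *
          (((k : ℝ) + 1 / 2)⁻¹) ^ (P + R + 1 - i) * (0 : ℝ) ^ (i + 2) = 0 := by
      apply Finset.sum_eq_zero; intro i _; simp
    rw [h3]
    simp only [ne_eq, Nat.add_eq_zero_iff, OfNat.ofNat_ne_zero, and_false, not_false_eq_true,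
      zero_pow, zero_mul]
    linarith
  · have hn : (n : ℝ) ≠ 0 := by exact_mod_cast h
    have hv := a_sub_ne n k
    have hw := a_ne k
    have hh : (n : ℝ)⁻¹ * ((k : ℝ) + 1 / 2 - n)⁻¹
        = ((k : ℝ) + 1 / 2)⁻¹ * ((n : ℝ)⁻¹ + ((k : ℝ) + 1 / 2 - n)⁻¹) := by
      rw [inv_add_inv hn hv, add_sub_cancel, ← mul_div_assoc, inv_mul_cancel₀ hw, ← mul_inv,
        ← one_div (_ * _)]
    have key := pf _ _ _ hh P (R + 1)
    rw [hA, hB] at key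
    rw [if_neg h, gg]
    linear_combination key

lemma col (P R k : ℕ) : HasSum (fun n : ℤ => gg P R n k)
    (∑ i ∈ Finset.range R, (Nat.choose (P + R - i) P : ℝ) *
          (((k : ℝ) + 1 / 2)⁻¹) ^ (P + R + 1 - i) * ((1 + (-1) ^ (i + 2)) * zetaC (i + 2))
      + ∑ i ∈ Finset.range P, (Nat.choose (P + R - i) (R + 1) : ℝ) *
          (((k : ℝ) + 1 / 2)⁻¹) ^ (P + R + 1 - i) * ((1 + (-1) ^ (i + 2)) * ttil (i + 2))
      - (Nat.choose (P + R + 2) P : ℝ) * (((k : ℝ) + 1 / 2)⁻¹) ^ (P + R + 3)) := by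
  simp only [gg_eq]
  have h0 := (hT k).mul_left
    ((Nat.choose (P + R + 1) P : ℝ) * (((k : ℝ) + 1 / 2)⁻¹) ^ (P + R + 2))
  have h1 := hasSum_sum (s := Finset.range R) fun i _ => (hZ (i + 2) (by omega)).mul_left
    ((Nat.choose (P + R - i) P : ℝ) * (((k : ℝ) + 1 / 2)⁻¹) ^ (P + R + 1 - i))
  have h2 := hasSum_sum (s := Finset.range P) fun i _ => (hY (i + 2) (by omega) k).mul_left
    ((Nat.choose (P + R - i) (R + 1) : ℝ) * (((k : ℝ) + 1 / 2)⁻¹) ^ (P + R + 1 - i))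
  have h3 := hasSum_ite_eq (0 : ℤ)
    ((Nat.choose (P + R + 2) P : ℝ) * (((k : ℝ) + 1 / 2)⁻¹) ^ (P + R + 3))
  have := ((h0.add h1).add h2).sub h3
  rw [mul_zero, zero_add] at this
  exact this

/-- the closed form of the double sum -/
noncomputable def EE (P R : ℕ) : ℝ :=
  ∑ i ∈ Finset.range R, (Nat.choose (P + R - i) P : ℝ) *
          ttil (P + R + 1 - i) * ((1 + (-1) ^ (i + 2)) * zetaC (i + 2))
      + ∑ i ∈ Finset.range P, (Nat.choose (P + R - i) (R + 1) : ℝ) *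
          ttil (P + R + 1 - i) * ((1 + (-1) ^ (i + 2)) * ttil (i + 2))
      - (Nat.choose (P + R + 2) P : ℝ) * ttil (P + R + 3)

lemma total (P R : ℕ) : HasSum (fun x : ℤ × ℕ => gg P R x.1 x.2) (EE P R) := by
  have h := (summ_gg P R).hasSum
  have h' := (Equiv.hasSum_iff (Equiv.prodComm ℕ ℤ)).2 h
  have h2 := h'.prod_fiberwise (fun k => col P R k)
  have h1 := hasSum_sum (s := Finset.range R) fun i hi =>
    ((hasSum_ttil (P + R + 1 - i) (by have := Finset.mem_range.1 hi; omega)).mul_left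
    (Nat.choose (P + R - i) P : ℝ)).mul_right ((1 + (-1) ^ (i + 2)) * zetaC (i + 2))
  have h3 := hasSum_sum (s := Finset.range P) fun i hi =>
    ((hasSum_ttil (P + R + 1 - i) (by have := Finset.mem_range.1 hi; omega)).mul_left
    (Nat.choose (P + R - i) (R + 1) : ℝ)).mul_right ((1 + (-1) ^ (i + 2)) * ttil (i + 2))
  have h4 := (hasSum_ttil (P + R + 3) (by omega)).mul_left (Nat.choose (P + R + 2) P : ℝ)
  have h5 := (h1.add h3).sub h4
  have h6 := h2.unique h5
  rw [h6] at h
  exact h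

lemma lhs_eq (P R : ℕ) (hodd : (-1 : ℝ) ^ R = - (-1) ^ (P + 1)) :
    HasSum (fun n : ℕ => 2 * (-1) ^ (P + 1) * (oddH (P + 1) (n + 1) / ((n : ℝ) + 1) ^ (R + 2)))
      (EE P R) := by
  have h := total P R
  have hr : ∀ n : ℤ, HasSum (fun k : ℕ => gg P R n k) (∑' k : ℕ, gg P R n k) := fun n =>
    ((summ_row P n).mul_left _).hasSum
  have h1 := (h.prod_fiberwise hr).nat_add_neg
  have hpos : ∀ N : ℕ, ∑' k : ℕ, gg P R (N : ℤ) k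
      = ((N : ℝ)⁻¹) ^ (R + 2) * ((-1) ^ (P + 1) * oddH (P + 1) N) := fun N =>
    ((row_pos P N).mul_left _).tsum_eq
  have hneg : ∀ N : ℕ, ∑' k : ℕ, gg P R (-(N : ℤ)) k
      = ((((-(N : ℤ) : ℤ) : ℝ))⁻¹) ^ (R + 2) * (-oddH (P + 1) N) := fun N =>
    ((row_neg P N).mul_left _).tsum_eq
  have h0 : ∑' k : ℕ, gg P R 0 k = 0 := by simp [gg]
  have e : (fun N : ℕ => ∑' k : ℕ, gg P R (N : ℤ) k + ∑' k : ℕ, gg P R (-(N : ℤ)) k)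
      = fun N : ℕ => 2 * (-1) ^ (P + 1) * (oddH (P + 1) N / (N : ℝ) ^ (R + 2)) := by
    ext N
    rw [hpos, hneg]
    push_cast
    rw [inv_neg, neg_pow ((N : ℝ)⁻¹), pow_add (-1 : ℝ) R 2, hodd, inv_pow]
    ring
  rw [h0, add_zero, e] at h1
  have h2 := (hasSum_nat_add_iff' 1).2 h1
  simpa [oddH] using h2

lemma even_sum (F : ℕ → ℝ) (q : ℕ) :
    ∑ j ∈ Finset.Icc 1 (q / 2), 2 * F (2 * j)
      = ∑ i ∈ Finset.range (q + 1), (1 + (-1) ^ i) * F i - 2 * F 0 := by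
  induction q with
  | zero => simp; ring
  | succ q ih =>
    rw [Finset.sum_range_succ]
    rcases Nat.even_or_odd' q with ⟨m, h | h⟩
    · have h1 : (q + 1) / 2 = q / 2 := by omega
      have h2 : (-1 : ℝ) ^ (q + 1) = -1 := by
        apply Odd.neg_one_pow; exact ⟨m, by omega⟩
      rw [h1, ih, h2]; ring
    · have h1 : (q + 1) / 2 = q / 2 + 1 := by omega
      have h2 : (-1 : ℝ) ^ (q + 1) = 1 := by
        apply Even.neg_one_pow; exact ⟨m + 1, by omega⟩
      have h3 : 2 * (q / 2 + 1) = q + 1 := by omega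
      rw [h1, Finset.sum_Icc_succ_top (by omega), ih, h2, h3]; ring

theorem alt_formula_4_5 (p q : ℕ) (hp : 1 ≤ p) (hq : 2 ≤ q) (hpq : Odd (p + q)) :
    2 * (∑' n : ℕ, oddH p (n + 1) / ((n : ℝ) + 1) ^ q) =
      -(-1 : ℝ) ^ p * (1 + (-1 : ℝ) ^ q) * ttil p * zetaC q
      - (-1 : ℝ) ^ p * (Nat.choose (p + q - 1) (p - 1) : ℝ) * ttil (p + q)
      - (-1 : ℝ) ^ p * ∑ k ∈ Finset.range p,
          ((-1 : ℝ) ^ k - 1) * (Nat.choose (p + q - k - 2) (q - 1) : ℝ) *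
            ttil (k + 1) * ttil (p + q - k - 1)
      + 2 * (-1 : ℝ) ^ p * ∑ j ∈ Finset.Icc 1 (q / 2),
          (Nat.choose (p + q - 2 * j - 1) (p - 1) : ℝ) * zetaC (2 * j) * ttil (p + q - 2 * j) := by
  obtain ⟨P, rfl⟩ : ∃ P, p = P + 1 := ⟨p - 1, by omega⟩
  obtain ⟨R, rfl⟩ : ∃ R, q = R + 2 := ⟨q - 2, by omega⟩
  have hsq : ((-1 : ℝ) ^ (P + 1)) * (-1) ^ (P + 1) = 1 := by
    rw [← mul_pow]; simp
  have hodd : (-1 : ℝ) ^ R = - (-1) ^ (P + 1) := by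
    have h1 : (-1 : ℝ) ^ (P + 1 + (R + 2)) = -1 := hpq.neg_one_pow
    have h2 : (-1 : ℝ) ^ (P + 1) * (-1) ^ R = -1 := by
      rw [pow_add, pow_add _ R 2] at h1
      simpa using h1
    linear_combination (-1 : ℝ) ^ (P + 1) * h2 - (-1 : ℝ) ^ R * hsq
  have hL := (lhs_eq P R hodd).tsum_eq
  rw [tsum_mul_left] at hL
  -- the sum over `k`
  have hK : ∑ k ∈ Finset.range (P + 1),
          ((-1 : ℝ) ^ k - 1) * (Nat.choose (P + 1 + (R + 2) - k - 2) (R + 2 - 1) : ℝ) *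
            ttil (k + 1) * ttil (P + 1 + (R + 2) - k - 1)
      = - ∑ i ∈ Finset.range P, (Nat.choose (P + R - i) (R + 1) : ℝ) *
          ttil (P + R + 1 - i) * ((1 + (-1) ^ (i + 2)) * ttil (i + 2)) := by
    rw [Finset.sum_range_succ', ← Finset.sum_neg_distrib]
    simp only [pow_zero, sub_self, zero_mul, add_zero]
    apply Finset.sum_congr rfl
    intro i _
    have h1 : P + 1 + (R + 2) - (i + 1) - 2 = P + R - i := by omega
    have h2 : P + 1 + (R + 2) - (i + 1) - 1 = P + R + 1 - i := by omega
    have h3 : R + 2 - 1 = R + 1 := by omega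
    rw [h1, h2, h3]
    ring
  have hJ : 2 * ∑ j ∈ Finset.Icc 1 ((R + 2) / 2),
          (Nat.choose (P + 1 + (R + 2) - 2 * j - 1) (P + 1 - 1) : ℝ) * zetaC (2 * j) *
            ttil (P + 1 + (R + 2) - 2 * j)
      = ∑ i ∈ Finset.range R, (Nat.choose (P + R - i) P : ℝ) *
          ttil (P + R + 1 - i) * ((1 + (-1) ^ (i + 2)) * zetaC (i + 2))
        + (1 + (-1 : ℝ) ^ (R + 2)) * ttil (P + 1) * zetaC (R + 2) := by
    have h := even_sum (fun i => (Nat.choose (P + 1 + (R + 2) - i - 1) (P + 1 - 1) : ℝ) * zetaC i *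
            ttil (P + 1 + (R + 2) - i)) (R + 2)
    rw [Finset.mul_sum, h, Finset.sum_range_succ, Finset.sum_range_succ', Finset.sum_range_succ']
    have h1 : P + 1 + (R + 2) - (R + 2) - 1 = P := by omega
    have h2 : P + 1 + (R + 2) - (R + 2) = P + 1 := by omega
    have h3 : ∑ i ∈ Finset.range R, (1 + (-1 : ℝ) ^ (i + 1 + 1)) *
        ((Nat.choose (P + 1 + (R + 2) - (i + 1 + 1) - 1) (P + 1 - 1) : ℝ) * zetaC (i + 1 + 1) *
            ttil (P + 1 + (R + 2) - (i + 1 + 1)))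
        = ∑ i ∈ Finset.range R, (Nat.choose (P + R - i) P : ℝ) *
          ttil (P + R + 1 - i) * ((1 + (-1) ^ (i + 2)) * zetaC (i + 2)) := by
      apply Finset.sum_congr rfl
      intro i hi
      have hi' := Finset.mem_range.1 hi
      have g1 : P + 1 + (R + 2) - (i + 1 + 1) - 1 = P + R - i := by omega
      have g2 : P + 1 + (R + 2) - (i + 1 + 1) = P + R + 1 - i := by omega
      rw [g1, g2, Nat.add_sub_cancel]
      ring
    rw [h3, h1, h2, Nat.add_sub_cancel, Nat.choose_self]
    simp only [zero_add, pow_one, pow_zero, Nat.cast_one]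
    ring
  have c1 : P + 1 + (R + 2) - 1 = P + R + 2 := by omega
  have c2 : P + 1 + (R + 2) = P + R + 3 := by omega
  rw [hK, c1, Nat.add_sub_cancel]
  rw [Nat.add_sub_cancel] at hJ
  have hE : EE P R = ∑ i ∈ Finset.range R, (Nat.choose (P + R - i) P : ℝ) *
          ttil (P + R + 1 - i) * ((1 + (-1) ^ (i + 2)) * zetaC (i + 2))
      + ∑ i ∈ Finset.range P, (Nat.choose (P + R - i) (R + 1) : ℝ) *
          ttil (P + R + 1 - i) * ((1 + (-1) ^ (i + 2)) * ttil (i + 2))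
      - (Nat.choose (P + R + 2) P : ℝ) * ttil (P + R + 3) := rfl
  rw [← c2] at hE
  linear_combination (-1 : ℝ) ^ (P + 1) * hL + (-1 : ℝ) ^ (P + 1) * hE - (-1 : ℝ) ^ (P + 1) * hJ
    - 2 * (∑' n : ℕ, oddH (P + 1) (n + 1) / ((n : ℝ) + 1) ^ (R + 2)) * hsq
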